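/- Let (W,S) be an irreducible Coxeter system (of arbitrary rank) with |W| = ∞ such that every finitely generated standard parabolic subgroup W_I (I ⊆ S finite) is finite. Then the Coxeter graph of (W,S) is isomorphic to one of: A_∞ (one-way infinite path, all labels 3), B_∞ (one-way infinite path with one terminal edge labelled 4, rest 3), D_∞ (one-way infinite path with a fork of two extra vertices at the end, all labels 3), or A_{∞,∞} (two-way infinite path, all labels 3). -/

import Mathlib

/-- Entries of the Coxeter matrix of type `A_∞` (one-way infinite path). -/
def aInfEntry (i j : ℕ) : ℕ :=
  if i = j then 1 else if i + 1 = j ∨ j + 1 = i then 3 else 2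

/-- Entries of the Coxeter matrix of type `B_∞` (one-way infinite path with the
terminal edge labelled `4`). -/
def bInfEntry (i j : ℕ) : ℕ :=
  if i = j then 1
  else if (i = 0 ∧ j = 1) ∨ (i = 1 ∧ j = 0) then 4
  else if i + 1 = j ∨ j + 1 = i then 3 else 2

/-- Entries of the Coxeter matrix of type `D_∞` (one-way infinite path with a
fork of two extra vertices at the end). -/
def dInfEntry (i j : ℕ) : ℕ :=
  if i = j then 1
  else if (i = 0 ∧ j = 2) ∨ (i = 2 ∧ j = 0) ∨ (i = 1 ∧ j = 2) ∨ (i = 2 ∧ j = 1) ∨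
      (2 ≤ i ∧ i + 1 = j) ∨ (2 ≤ j ∧ j + 1 = i) then 3
  else 2

/-- Entries of the Coxeter matrix of type `A_{∞,∞}` (two-way infinite path). -/
def aZZEntry (i j : ℤ) : ℕ :=
  if i = j then 1 else if i + 1 = j ∨ j + 1 = i then 3 else 2

namespace CoxeterMatrix

variable {B : Type*} (M : CoxeterMatrix B)

/-- The weight of the edge `ij` in the Coxeter graph; it is `1` for an edge labelled `∞`, which
is encoded by the entry `0`. -/
noncomputable def edgeWeight (i j : B) : ℝ := Real.cos (Real.pi / M i j)

/-- The coroot attached to `i` in the geometric representation. -/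
noncomputable def coroot (i : B) : (B →₀ ℝ) →ₗ[ℝ] ℝ :=
  Finsupp.linearCombination ℝ fun j => -2 * M.edgeWeight i j

theorem edgeWeight_comm (i j : B) : M.edgeWeight i j = M.edgeWeight j i := by
  simp [edgeWeight, M.symmetric i j]

@[simp]
theorem coroot_single (i j : B) : M.coroot i (Finsupp.single j 1) = -2 * M.edgeWeight i j := by
  simp [coroot]

theorem coroot_single_self (i : B) : M.coroot i (Finsupp.single i 1) = 2 := by
  simp [edgeWeight]

/-- The simple reflection of the geometric representation attached to `i`. -/
noncomputable def simpleReflection (i : B) : (B →₀ ℝ) ≃ₗ[ℝ] (B →₀ ℝ) :=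
  Module.reflection (M.coroot_single_self i)

theorem simpleReflection_apply (i : B) (v : B →₀ ℝ) :
    M.simpleReflection i v = v - M.coroot i v • Finsupp.single i 1 :=
  rfl

theorem simpleReflection_single_self (i : B) :
    M.simpleReflection i (Finsupp.single i 1) = -Finsupp.single i 1 :=
  Module.reflection_apply_self _

/-- If `θ = 2π/m`, the Chebyshev coefficients occurring in the `m`-th power of a product of two
reflections vanish. -/
theorem chebyshev_coefficients_eq_zero {m : ℕ} (hm : 3 ≤ m) {t : ℝ}
    (ht : t = 2 * Real.cos (2 * Real.pi / m)) :
    (Polynomial.Chebyshev.S ℝ (((m : ℤ) - 2) / 2)).eval t *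
      ((Polynomial.Chebyshev.S ℝ (((m : ℤ) - 1) / 2)).eval t +
        (Polynomial.Chebyshev.S ℝ (((m : ℤ) - 3) / 2)).eval t) = 0 ∧
    (Polynomial.Chebyshev.S ℝ (((m : ℤ) - 1) / 2)).eval t *
      ((Polynomial.Chebyshev.S ℝ ((m : ℤ) / 2)).eval t +
        (Polynomial.Chebyshev.S ℝ (((m : ℤ) - 2) / 2)).eval t) = 0 := by
  have hm' : (3 : ℝ) ≤ m := by exact_mod_cast hm
  set θ := 2 * Real.pi / m with hθ
  have hmθ : (m : ℝ) * θ = 2 * Real.pi := by rw [hθ]; field_simp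
  have hsin : Real.sin θ ≠ 0 := by
    refine (Real.sin_pos_of_pos_of_lt_pi (by positivity) ?_).ne'
    rw [hθ, div_lt_iff₀ (by positivity)]
    nlinarith [Real.pi_pos]
  have hS (k : ℤ) : (Polynomial.Chebyshev.S ℝ k).eval t * Real.sin θ = Real.sin ((k + 1) * θ) := by
    rw [ht, Polynomial.Chebyshev.S_two_mul_real_cos]
  obtain ⟨k, rfl | rfl⟩ := Nat.even_or_odd' m
  · have h0 : (Polynomial.Chebyshev.S ℝ ((k : ℤ) - 1)).eval t = 0 := by
      refine (mul_eq_zero.1 ((hS _).trans ?_)).resolve_right hsin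
      rw [show (((k : ℤ) - 1 : ℤ) + 1 : ℝ) * θ = Real.pi by push_cast at hmθ ⊢; linarith,
        Real.sin_pi]
    rw [show (((2 * k : ℕ) : ℤ) - 2) / 2 = (k : ℤ) - 1 by omega,
      show (((2 * k : ℕ) : ℤ) - 1) / 2 = (k : ℤ) - 1 by omega, h0]
    simp
  · have h0 : (Polynomial.Chebyshev.S ℝ (k : ℤ)).eval t +
        (Polynomial.Chebyshev.S ℝ ((k : ℤ) - 1)).eval t = 0 := by
      refine (mul_eq_zero.1 (?_ : _ * Real.sin θ = 0)).resolve_right hsin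
      rw [add_mul, hS, hS, show (((k : ℤ) : ℝ) + 1) * θ = 2 * Real.pi - k * θ by
        push_cast at hmθ ⊢; linarith, Real.sin_two_pi_sub]
      simp
    rw [show (((2 * k + 1 : ℕ) : ℤ) - 2) / 2 = (k : ℤ) - 1 by omega,
      show (((2 * k + 1 : ℕ) : ℤ) - 1) / 2 = (k : ℤ) by omega,
      show (((2 * k + 1 : ℕ) : ℤ) - 3) / 2 = (k : ℤ) - 1 by omega,
      show (((2 * k + 1 : ℕ) : ℤ)) / 2 = (k : ℤ) by omega, h0]
    simp

theorem isLiftable_simpleReflection : M.IsLiftable M.simpleReflection := by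
  intro i j
  obtain rfl | hij := eq_or_ne i j
  · rw [M.diagonal, pow_one]
    exact LinearEquiv.ext fun v => Module.involutive_reflection (M.coroot_single_self i) v
  have h1 := M.off_diagonal i j hij
  have hji : M.edgeWeight j i = Real.cos (Real.pi / M i j) := M.edgeWeight_comm j i
  have hij' : M.edgeWeight i j = Real.cos (Real.pi / M i j) := rfl
  generalize M i j = m at *
  obtain rfl | rfl | hm : m = 0 ∨ m = 2 ∨ 3 ≤ m := by omega
  · simp
  · rw [Nat.cast_ofNat, Real.cos_pi_div_two] at hji hij'
    refine LinearEquiv.ext fun v => ?_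
    simp only [pow_two, LinearEquiv.mul_apply, simpleReflection_apply, map_sub, map_smul,
      coroot_single, hij', hji, M.coroot_single_self, LinearEquiv.coe_one, id_eq,
      mul_zero]
    module
  · refine LinearEquiv.ext fun v => ?_
    have := Module.reflection_mul_reflection_pow_apply (M.coroot_single_self i)
      (M.coroot_single_self j) m v
    obtain ⟨h2, h3⟩ := chebyshev_coefficients_eq_zero hm
      (t := M.coroot i (Finsupp.single j 1) * M.coroot j (Finsupp.single i 1) - 2) (by
        rw [coroot_single, coroot_single, hji, hij', mul_div_assoc, Real.cos_two_mul]; ring)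
    rw [simpleReflection, simpleReflection, this, h2, h3]
    simp

end CoxeterMatrix

namespace CoxeterSystem

variable {B W : Type*} [Group W] {M : CoxeterMatrix B} (cs : CoxeterSystem M W)

/-- The geometric representation of a Coxeter group. -/
noncomputable def geometricRep : W →* ((B →₀ ℝ) ≃ₗ[ℝ] (B →₀ ℝ)) :=
  cs.lift ⟨M.simpleReflection, M.isLiftable_simpleReflection⟩

theorem geometricRep_simple (i : B) : cs.geometricRep (cs.simple i) = M.simpleReflection i :=
  cs.lift_apply_simple _ i

/-- The standard inner product on finitely supported functions. -/
noncomputable def stdForm (B : Type*) : (B →₀ ℝ) →ₗ[ℝ] (B →₀ ℝ) →ₗ[ℝ] ℝ :=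
  Finsupp.bilinearCombination ℝ ℝ ∘ₗ Finsupp.lcoeFun

theorem stdForm_self_pos {v : B →₀ ℝ} (hv : v ≠ 0) : 0 < stdForm B v v := by
  simp only [stdForm, LinearMap.comp_apply, Finsupp.lcoeFun_apply,
    Finsupp.bilinearCombination_apply, Finsupp.linearCombination_apply, smul_eq_mul]
  exact Finset.sum_pos (fun i hi => mul_self_pos.2 (Finsupp.mem_support_iff.1 hi))
    (Finsupp.support_nonempty_iff.2 hv)

/-- The average of the standard inner product over a finite subgroup. -/
noncomputable def averagedForm (H : Subgroup W) [Fintype H] :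
    (B →₀ ℝ) →ₗ[ℝ] (B →₀ ℝ) →ₗ[ℝ] ℝ :=
  ∑ h : H, (stdForm B).compl₁₂ (cs.geometricRep h).toLinearMap (cs.geometricRep h).toLinearMap

theorem averagedForm_apply (H : Subgroup W) [Fintype H] (x y : B →₀ ℝ) :
    cs.averagedForm H x y = ∑ h : H, stdForm B (cs.geometricRep h x) (cs.geometricRep h y) := by
  simp [averagedForm, LinearMap.sum_apply]

theorem averagedForm_self_pos (H : Subgroup W) [Fintype H] {v : B →₀ ℝ} (hv : v ≠ 0) :
    0 < cs.averagedForm H v v := by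
  rw [averagedForm_apply]
  exact Finset.sum_pos (fun h _ => stdForm_self_pos (by simpa using hv)) Finset.univ_nonempty

theorem averagedForm_geometricRep {H : Subgroup W} [Fintype H] {w : W} (hw : w ∈ H)
    (x y : B →₀ ℝ) :
    cs.averagedForm H (cs.geometricRep w x) (cs.geometricRep w y) = cs.averagedForm H x y := by
  rw [averagedForm_apply, averagedForm_apply]
  refine Fintype.sum_equiv (Equiv.mulRight ⟨w, hw⟩) _ _ fun h => ?_
  simp [LinearEquiv.mul_apply]

theorem two_mul_averagedForm_single {H : Subgroup W} [Fintype H] {i : B} (hi : cs.simple i ∈ H)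
    (v : B →₀ ℝ) :
    2 * cs.averagedForm H v (Finsupp.single i 1) =
      M.coroot i v * cs.averagedForm H (Finsupp.single i 1) (Finsupp.single i 1) := by
  have h := cs.averagedForm_geometricRep hi v (Finsupp.single i 1)
  rw [geometricRep_simple, M.simpleReflection_single_self, M.simpleReflection_apply] at h
  simp only [map_sub, map_smul, map_neg, LinearMap.sub_apply, LinearMap.smul_apply,
    smul_eq_mul] at h
  linarith

/-- A positive vector supported on a finite set of vertices generating a finite parabolic subgroup
cannot be subharmonic for the weighted adjacency operator of the Coxeter graph. -/
theorem exists_sum_mul_edgeWeight_neg {S : Finset B}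
    (hS : S.Nonempty)
    (hfin : ((Subgroup.closure (cs.simple '' S) : Subgroup W) : Set W).Finite)
    {c : B → ℝ} (hc : ∀ i ∈ S, 0 < c i) :
    ∃ i ∈ S, ∑ j ∈ S, c j * M.edgeWeight i j < 0 := by
  classical
  by_contra! hcon
  set H := Subgroup.closure (cs.simple '' S)
  have : Fintype H := hfin.fintype
  set v : B →₀ ℝ := ∑ i ∈ S, c i • Finsupp.single i 1 with hv
  have hv0 : v ≠ 0 := by
    obtain ⟨i, hi⟩ := hS
    intro h
    have := DFunLike.congr_fun h i
    simp [hv, Finsupp.finsetSum_apply, Finsupp.single_apply, hi, (hc i hi).ne'] at this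
  have hcoroot (i) (hi : i ∈ S) : M.coroot i v ≤ 0 := by
    have h1 : M.coroot i v = -2 * ∑ j ∈ S, c j * M.edgeWeight i j := by
      rw [hv, map_sum, Finset.mul_sum]
      refine Finset.sum_congr rfl fun j _ => ?_
      rw [map_smul, CoxeterMatrix.coroot_single, smul_eq_mul]
      ring
    linarith [hcon i hi]
  have hpos := cs.averagedForm_self_pos H hv0
  have : cs.averagedForm H v v ≤ 0 := by
    nth_rewrite 2 [hv]
    rw [map_sum]
    refine Finset.sum_nonpos fun i hi => ?_
    have h1 := cs.two_mul_averagedForm_single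
      (Subgroup.subset_closure ⟨i, hi, rfl⟩ : cs.simple i ∈ H) v
    have h2 := cs.averagedForm_self_pos H
      (Finsupp.single_ne_zero.2 one_ne_zero : (Finsupp.single i (1 : ℝ)) ≠ 0)
    rw [map_smul, smul_eq_mul]
    have h3 := mul_nonpos_of_nonpos_of_nonneg (hcoroot i hi) h2.le
    have := hc i hi
    nlinarith
  linarith

end CoxeterSystem

namespace CoxeterMatrix

variable {B : Type*} {M : CoxeterMatrix B}

theorem edgeWeight_self (i : B) : M.edgeWeight i i = -1 := by
  simp [edgeWeight]

theorem cos_pi_div_le_edgeWeight {n : ℕ} (hn : 0 < n) {i j : B} (h : M i j = 0 ∨ n ≤ M i j) :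
    Real.cos (Real.pi / n) ≤ M.edgeWeight i j := by
  rw [edgeWeight]
  obtain h | h := h
  · simpa [h] using Real.cos_le_one _
  · have h1 : (1 : ℝ) ≤ n := by exact_mod_cast hn
    refine Real.cos_le_cos_of_nonneg_of_le_pi (by positivity)
      (div_le_self Real.pi_pos.le h1) ?_
    gcongr

theorem edgeWeight_nonneg {i j : B} (h : i ≠ j) : 0 ≤ M.edgeWeight i j := by
  have h1 := M.off_diagonal i j h
  simpa using cos_pi_div_le_edgeWeight (n := 2) two_pos (show M i j = 0 ∨ 2 ≤ M i j by omega)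

theorem half_le_edgeWeight {i j : B} (h : i ≠ j) (h2 : M i j ≠ 2) : 1 / 2 ≤ M.edgeWeight i j := by
  have h1 := M.off_diagonal i j h
  simpa using cos_pi_div_le_edgeWeight (n := 3) three_pos (show M i j = 0 ∨ 3 ≤ M i j by omega)

theorem sqrt_two_div_two_le_edgeWeight {i j : B} (h : M i j = 0 ∨ 4 ≤ M i j) :
    √2 / 2 ≤ M.edgeWeight i j := by
  simpa using cos_pi_div_le_edgeWeight (n := 4) four_pos h

theorem four_fifths_le_edgeWeight {i j : B} (h : M i j = 0 ∨ 5 ≤ M i j) :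
    4 / 5 ≤ M.edgeWeight i j := by
  have h1 := cos_pi_div_le_edgeWeight (n := 5) (by simp) h
  push_cast at h1
  rw [Real.cos_pi_div_five] at h1
  have : 11 / 5 ≤ √5 := Real.le_sqrt_of_sq_le (by norm_num)
  linarith

/-- Every finite set of vertices generates a finite standard parabolic subgroup, in the form in
which it is used: no positive vector on a finite set of vertices is subharmonic. -/
def IsLocallyPositive (M : CoxeterMatrix B) : Prop :=
  ∀ ⦃S : Finset B⦄ ⦃c : B → ℝ⦄, S.Nonempty → (∀ i ∈ S, 0 < c i) →
    ∃ i ∈ S, ∀ T ⊆ S, i ∉ T → ∑ j ∈ T, c j * M.edgeWeight i j < c i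

end CoxeterMatrix

theorem CoxeterSystem.isLocallyPositive {B W : Type*} [Group W] {M : CoxeterMatrix B}
    (cs : CoxeterSystem M W)
    (hfin : ∀ I : Set B, I.Finite →
      ((Subgroup.closure (cs.simple '' I) : Subgroup W) : Set W).Finite) :
    M.IsLocallyPositive := by
  classical
  intro S c hS hc
  obtain ⟨i, hi, hlt⟩ := cs.exists_sum_mul_edgeWeight_neg hS (hfin _ S.finite_toSet) hc
  refine ⟨i, hi, fun T hT hiT => ?_⟩
  have h1 : ∑ j ∈ insert i T, c j * M.edgeWeight i j ≤ ∑ j ∈ S, c j * M.edgeWeight i j := by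
    refine Finset.sum_le_sum_of_subset_of_nonneg (Finset.insert_subset hi hT) fun j hj hj' => ?_
    exact mul_nonneg (hc j hj).le (CoxeterMatrix.edgeWeight_nonneg (by aesop))
  rw [Finset.sum_insert hiT, CoxeterMatrix.edgeWeight_self] at h1
  linarith

namespace CoxeterMatrix

variable {B : Type*} {M : CoxeterMatrix B}

/-- The Coxeter graph, without its labels. -/
def graph (M : CoxeterMatrix B) : SimpleGraph B where
  Adj i j := i ≠ j ∧ M i j ≠ 2
  symm := ⟨fun i j h => ⟨h.1.symm, by rw [M.symmetric]; exact h.2⟩⟩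
  loopless := ⟨fun _ h => h.1 rfl⟩

/-- An edge of the Coxeter graph is heavy if its label is at least `4`, possibly infinite. -/
def IsHeavy (M : CoxeterMatrix B) (i j : B) : Prop := M i j = 0 ∨ 4 ≤ M i j

theorem IsHeavy.symm {i j : B} (h : M.IsHeavy i j) : M.IsHeavy j i := by
  rwa [IsHeavy, M.symmetric]

theorem half_le_edgeWeight_of_adj {i j : B} (h : M.graph.Adj i j) : 1 / 2 ≤ M.edgeWeight i j :=
  half_le_edgeWeight h.1 h.2

theorem eq_three_of_adj {i j : B} (h : M.graph.Adj i j) (h' : ¬ M.IsHeavy i j) : M i j = 3 := by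
  have h1 := M.off_diagonal i j h.1
  have h2 := h.2
  simp only [IsHeavy, not_or] at h'
  omega

theorem eq_two_of_not_adj {i j : B} (h : i ≠ j) (h' : ¬ M.graph.Adj i j) : M i j = 2 := by
  by_contra h2
  exact h' ⟨h, h2⟩

namespace IsLocallyPositive

theorem exists_sum_lt (h : M.IsLocallyPositive) {ι : Type*} {g : ι → B}
    (hg : g.Injective) {S : Finset ι} {c : ι → ℝ} (hS : S.Nonempty) (hc : ∀ i ∈ S, 0 < c i) :
    ∃ i ∈ S, ∀ T ⊆ S, i ∉ T → ∑ j ∈ T, c j * M.edgeWeight (g i) (g j) < c i := by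
  obtain ⟨b, hb, hlt⟩ := h (S := S.map ⟨g, hg⟩) (c := Function.extend g c 0) (hS.map) (by
    intro b hb
    obtain ⟨i, hi, rfl⟩ := Finset.mem_map.1 hb
    simpa [hg.extend_apply] using hc i hi)
  obtain ⟨i, hi, rfl⟩ := Finset.mem_map.1 hb
  refine ⟨i, hi, fun T hT hiT => ?_⟩
  simpa [hg.extend_apply] using hlt (T.map ⟨g, hg⟩) (Finset.map_subset_map.2 hT) (by simpa)

/-- A finite configuration with a positive subharmonic vector is forbidden. -/
theorem not_subharmonic (h : M.IsLocallyPositive) {ι : Type*} {g : ι → B} (hg : g.Injective)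
    {S : Finset ι} {c : ι → ℝ} (hS : S.Nonempty) (hc : ∀ i ∈ S, 0 < c i)
    (hsub : ∀ i ∈ S, ∃ T ⊆ S, i ∉ T ∧ c i ≤ ∑ j ∈ T, c j * M.edgeWeight (g i) (g j)) : False := by
  obtain ⟨i, hi, hlt⟩ := h.exists_sum_lt hg hS hc
  obtain ⟨T, hT, hiT, hle⟩ := hsub i hi
  exact (hlt T hT hiT).not_ge hle

theorem isAcyclic (h : M.IsLocallyPositive) : M.graph.IsAcyclic := by
  classical
  intro v p hp
  refine h.not_subharmonic Function.injective_id (S := p.support.toFinset) (c := 1)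
    ⟨v, by simp⟩ (by simp) fun i hi => ?_
  obtain ⟨a, b, hab, hN⟩ := Set.ncard_eq_two.1
    (hp.ncard_neighborSet_toSubgraph_eq_two (List.mem_toFinset.1 hi))
  have ha : p.toSubgraph.Adj i a := by
    rw [← SimpleGraph.Subgraph.mem_neighborSet, hN]; simp
  have hb : p.toSubgraph.Adj i b := by
    rw [← SimpleGraph.Subgraph.mem_neighborSet, hN]; simp
  refine ⟨{a, b}, ?_, ?_, ?_⟩
  · intro x hx
    simp only [Finset.mem_insert, Finset.mem_singleton] at hx
    rw [List.mem_toFinset, ← SimpleGraph.Walk.mem_verts_toSubgraph]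
    obtain rfl | rfl := hx
    exacts [ha.snd_mem, hb.snd_mem]
  · simp [ha.adj_sub.ne, hb.adj_sub.ne]
  · rw [Finset.sum_pair hab]
    have h1 := half_le_edgeWeight_of_adj ha.adj_sub
    have h2 := half_le_edgeWeight_of_adj hb.adj_sub
    simp only [Pi.one_apply, one_mul, id_eq]
    linarith

theorem card_ne_four_of_adj (h : M.IsLocallyPositive) {r : B} {T : Finset B}
    (hT : ∀ x ∈ T, M.graph.Adj r x) : T.card ≠ 4 := by
  classical
  intro hcard
  have hr : r ∉ T := fun hr => (hT r hr).ne rfl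
  refine h.not_subharmonic Function.injective_id (S := insert r T)
    (c := fun x => if x = r then 2 else 1) ⟨r, by simp⟩ (fun i _ => by split_ifs <;> norm_num)
    fun i hi => ?_
  obtain rfl | hi := Finset.mem_insert.1 hi
  · refine ⟨T, Finset.subset_insert _ _, hr, ?_⟩
    have : ∑ j ∈ T, (1 / 2 : ℝ) ≤
        ∑ j ∈ T, (if j = i then 2 else 1) * M.edgeWeight (id i) (id j) := by
      refine Finset.sum_le_sum fun j hj => ?_
      rw [if_neg (hT j hj).ne', one_mul]
      exact half_le_edgeWeight_of_adj (hT j hj)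
    refine le_trans ?_ this
    rw [Finset.sum_const, hcard]
    norm_num
  · refine ⟨{r}, by simp, by simpa using (hT i hi).ne', ?_⟩
    have := half_le_edgeWeight_of_adj (hT i hi).symm
    simp only [(hT i hi).ne', if_false, Finset.sum_singleton, if_true, id_eq]
    linarith

theorem finite_neighborSet (h : M.IsLocallyPositive) (r : B) : (M.graph.neighborSet r).Finite := by
  by_contra hinf
  obtain ⟨T, hT, hcard⟩ := Set.Infinite.exists_subset_card_eq hinf 4
  exact h.card_ne_four_of_adj (r := r) (fun x hx => hT hx) hcard

/-- The affine diagram of type `D`: a path with a fork at both ends. -/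
theorem not_affineD (h : M.IsLocallyPositive) {g : ℕ → B} (hg : g.Injective) {n : ℕ}
    (h0 : M.graph.Adj (g 0) (g (n + 4))) (h1 : M.graph.Adj (g 1) (g 3))
    (h2 : M.graph.Adj (g 2) (g 3)) (hk : ∀ k, 3 ≤ k → M.graph.Adj (g k) (g (k + 1))) : False := by
  refine h.not_subharmonic hg (S := Finset.range (n + 6))
    (c := fun i => if i < 3 ∨ i = n + 5 then 1 else 2) ⟨0, by simp⟩
    (fun i _ => by split_ifs <;> norm_num) fun i hi => ?_
  rw [Finset.mem_range] at hi
  have w0 := half_le_edgeWeight_of_adj h0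
  have w0' := half_le_edgeWeight_of_adj h0.symm
  have w1 := half_le_edgeWeight_of_adj h1
  have w1' := half_le_edgeWeight_of_adj h1.symm
  have w2 := half_le_edgeWeight_of_adj h2
  have w2' := half_le_edgeWeight_of_adj h2.symm
  have w k (h3 : 3 ≤ k) := half_le_edgeWeight_of_adj (hk k h3)
  have w' k (h3 : 3 ≤ k) := half_le_edgeWeight_of_adj (hk k h3).symm
  have hT {T : Finset ℕ} (hT : ∀ j ∈ T, j < n + 6) : T ⊆ Finset.range (n + 6) :=
    fun j hj => Finset.mem_range.2 (hT j hj)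
  have hn4 : ¬ n + 4 < 3 := by omega
  obtain rfl | rfl | rfl | rfl | rfl | rfl | ⟨h4, h5⟩ : i = 0 ∨ i = 1 ∨ i = 2 ∨ i = 3 ∨
    i = n + 4 ∨ i = n + 5 ∨ 3 < i ∧ i < n + 4 := by omega
  · refine ⟨{n + 4}, hT (by simp), by simp, ?_⟩
    simp [hn4]
    linarith
  · refine ⟨{3}, hT (by simp), by simp, ?_⟩
    simp
    linarith
  · refine ⟨{3}, hT (by simp), by simp, ?_⟩
    simp
    linarith
  · refine ⟨{1, 2, 4}, hT (by simp), by simp, ?_⟩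
    have := w 3 le_rfl
    simp
    linarith
  · refine ⟨{0, n + 3, n + 5}, hT (by simp), by simp, ?_⟩
    have := w (n + 4) (by omega)
    have := w' (n + 3) (by omega)
    simp [hn4]
    linarith
  · refine ⟨{n + 4}, hT (by simp), by simp, ?_⟩
    have := w' (n + 4) (by omega)
    simp [hn4]
    linarith
  · obtain ⟨i, rfl⟩ := Nat.exists_eq_add_of_lt h4
    refine ⟨{3 + i, 3 + i + 2}, hT (by simp; omega), by simp, ?_⟩
    have := w (3 + i + 1) (by omega)
    have := w' (3 + i) (by omega)
    rw [Finset.sum_pair (by omega), if_neg (by omega), if_neg (by omega), if_neg (by omega)]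
    linarith

/-- The affine diagram of type `B`: a path with a fork at one end and a heavy edge at the other. -/
theorem not_affineB (h : M.IsLocallyPositive) {g : ℕ → B} (hg : g.Injective) {n : ℕ}
    (h0 : M.graph.Adj (g 0) (g 2)) (h1 : M.graph.Adj (g 1) (g 2))
    (hk : ∀ k, 2 ≤ k → k < n + 2 → M.graph.Adj (g k) (g (k + 1))) :
    ¬ M.IsHeavy (g (n + 2)) (g (n + 3)) := by
  intro hn
  have hsq : √2 * √2 = (2 : ℝ) := Real.mul_self_sqrt zero_le_two
  have hs0 : 0 < √2 := by positivity
  refine h.not_subharmonic hg (S := Finset.range (n + 4))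
    (c := fun i => if i < 2 then 1 else if i = n + 3 then √2 else 2) ⟨0, by simp⟩
    (fun i _ => by split_ifs <;> positivity) fun i hi => ?_
  rw [Finset.mem_range] at hi
  have w0 := half_le_edgeWeight_of_adj h0
  have w0' := half_le_edgeWeight_of_adj h0.symm
  have w1 := half_le_edgeWeight_of_adj h1
  have w1' := half_le_edgeWeight_of_adj h1.symm
  have wn := sqrt_two_div_two_le_edgeWeight hn
  have wn' := sqrt_two_div_two_le_edgeWeight hn.symm
  have w k (h2 : 2 ≤ k) (h3 : k < n + 2) := half_le_edgeWeight_of_adj (hk k h2 h3)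
  have w' k (h2 : 2 ≤ k) (h3 : k < n + 2) := half_le_edgeWeight_of_adj (hk k h2 h3).symm
  have hT {T : Finset ℕ} (hT : ∀ j ∈ T, j < n + 4) : T ⊆ Finset.range (n + 4) :=
    fun j hj => Finset.mem_range.2 (hT j hj)
  obtain rfl | rfl | rfl | hi' : i = 0 ∨ i = 1 ∨ i = n + 3 ∨ 2 ≤ i ∧ i < n + 3 := by omega
  · refine ⟨{2}, hT (by simp), by simp, ?_⟩
    simp
    linarith
  · refine ⟨{2}, hT (by simp), by simp, ?_⟩
    simp
    linarith
  · refine ⟨{n + 2}, hT (by simp), by simp, ?_⟩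
    simp
    linarith
  · obtain ⟨i, rfl⟩ := Nat.exists_eq_add_of_le' hi'.1
    have wnext : (1 : ℝ) ≤ (if i + 3 = n + 3 then √2 else 2) *
        M.edgeWeight (g (i + 2)) (g (i + 3)) := by
      split_ifs with h
      · obtain rfl : i = n := by omega
        nlinarith
      · linarith [w (i + 2) (by omega) (by omega)]
    obtain rfl | hi0 := Nat.eq_zero_or_pos i
    · refine ⟨{0, 1, 3}, hT (by simp), by simp, ?_⟩
      simp at wnext ⊢
      linarith
    · refine ⟨{i + 1, i + 3}, hT (by simp; omega), by simp, ?_⟩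
      have := w' (i + 1) (by omega) (by omega)
      rw [Finset.sum_pair (by omega), if_neg (by omega), if_neg (by omega), if_neg (by omega),
        if_neg (by omega), if_neg (by omega)]
      linarith

/-- The affine diagram of type `E₈`: a branch vertex with arms of lengths `1`, `2` and `5`. -/
theorem not_affineE (h : M.IsLocallyPositive) {g : ℕ → B} (hg : g.Injective)
    (h0 : M.graph.Adj (g 0) (g 1)) (h1 : M.graph.Adj (g 1) (g 3))
    (h2 : M.graph.Adj (g 2) (g 3)) (hk : ∀ k, 3 ≤ k → M.graph.Adj (g k) (g (k + 1))) : False := by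
  refine h.not_subharmonic hg (S := Finset.range 9)
    (c := fun i => if i = 0 then 2 else if i = 1 then 4 else if i = 2 then 3 else 9 - i)
    ⟨0, by simp⟩ (fun i hi => ?_) fun i hi => ?_
  · have : (i : ℝ) < 9 := by exact_mod_cast Finset.mem_range.1 hi
    split_ifs <;> linarith
  rw [Finset.mem_range] at hi
  have w0 := half_le_edgeWeight_of_adj h0
  have w0' := half_le_edgeWeight_of_adj h0.symm
  have w1 := half_le_edgeWeight_of_adj h1
  have w1' := half_le_edgeWeight_of_adj h1.symm
  have w2 := half_le_edgeWeight_of_adj h2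
  have w2' := half_le_edgeWeight_of_adj h2.symm
  have w k (h3 : 3 ≤ k) := half_le_edgeWeight_of_adj (hk k h3)
  have w' k (h3 : 3 ≤ k) := half_le_edgeWeight_of_adj (hk k h3).symm
  obtain rfl | rfl | rfl | rfl | rfl | hi' : i = 0 ∨ i = 1 ∨ i = 2 ∨ i = 3 ∨ i = 8 ∨
    4 ≤ i ∧ i < 8 := by omega
  · refine ⟨{1}, by decide, by simp, ?_⟩
    simp
    linarith
  · refine ⟨{0, 3}, by decide, by simp, ?_⟩
    simp
    linarith
  · refine ⟨{3}, by decide, by simp, ?_⟩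
    simp
    linarith
  · refine ⟨{1, 2, 4}, by decide, by simp, ?_⟩
    have := w 3 le_rfl
    simp
    linarith
  · refine ⟨{7}, by decide, by simp, ?_⟩
    have := w' 7 (by omega)
    simp
    linarith
  · obtain ⟨i, rfl⟩ := Nat.exists_eq_add_of_le' hi'.1
    refine ⟨{i + 3, i + 5}, ?_, by simp, ?_⟩
    · intro j hj
      simp at hj ⊢
      omega
    have h5 := w (i + 4) (by omega)
    have h3 := w' (i + 3) (by omega)
    have : (i : ℝ) < 4 := by exact_mod_cast (show i < 4 by omega)
    rw [Finset.sum_pair (by omega)]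
    simp
    nlinarith

/-- The affine diagram of type `F₄`: a path with labels `3, 4, 3, 3`. -/
theorem not_affineF (h : M.IsLocallyPositive) {g : ℕ → B} (hg : g.Injective)
    (hk : ∀ k, M.graph.Adj (g k) (g (k + 1))) : ¬ M.IsHeavy (g 1) (g 2) := by
  intro hn
  have hsq : √2 * √2 = (2 : ℝ) := Real.mul_self_sqrt zero_le_two
  have hs0 : 0 < √2 := by positivity
  refine h.not_subharmonic hg (S := Finset.range 5)
    (c := fun i => if i = 0 then √2 else if i = 1 then 2 * √2 else 5 - i)
    ⟨0, by simp⟩ (fun i hi => ?_) fun i hi => ?_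
  · have : (i : ℝ) < 5 := by exact_mod_cast Finset.mem_range.1 hi
    split_ifs <;> linarith
  rw [Finset.mem_range] at hi
  have wn := sqrt_two_div_two_le_edgeWeight hn
  have wn' := sqrt_two_div_two_le_edgeWeight hn.symm
  have w k := half_le_edgeWeight_of_adj (hk k)
  have w' k := half_le_edgeWeight_of_adj (hk k).symm
  interval_cases i
  · refine ⟨{1}, by decide, by simp, ?_⟩
    have := w 0
    simp at this ⊢
    nlinarith
  · refine ⟨{0, 2}, by decide, by simp, ?_⟩
    have := w' 0
    simp at this ⊢
    nlinarith
  · refine ⟨{1, 3}, by decide, by simp, ?_⟩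
    have := w 2
    simp at this ⊢
    nlinarith
  · refine ⟨{2, 4}, by decide, by simp, ?_⟩
    have h1 := w 3
    have h2 := w' 2
    simp at h1 h2 ⊢
    linarith
  · refine ⟨{3}, by decide, by simp, ?_⟩
    have := w' 3
    simp at this ⊢
    linarith

/-- The hyperbolic diagram extending `H₄`: a path with labels `5, 3, 3, 3`. -/
theorem not_hyperbolicH (h : M.IsLocallyPositive) {g : ℕ → B} (hg : g.Injective)
    (hk : ∀ k, M.graph.Adj (g k) (g (k + 1))) : ¬ (M (g 0) (g 1) = 0 ∨ 5 ≤ M (g 0) (g 1)) := by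
  intro hn
  refine h.not_subharmonic hg (S := Finset.range 5)
    (c := fun i => if i = 0 then 16 / 5 else 5 - i)
    ⟨0, by simp⟩ (fun i hi => ?_) fun i hi => ?_
  · have : (i : ℝ) < 5 := by exact_mod_cast Finset.mem_range.1 hi
    split_ifs <;> linarith
  rw [Finset.mem_range] at hi
  have wn := four_fifths_le_edgeWeight hn
  have wn' := four_fifths_le_edgeWeight (M.symmetric _ _ ▸ hn)
  have w k := half_le_edgeWeight_of_adj (hk k)
  have w' k := half_le_edgeWeight_of_adj (hk k).symm
  interval_cases i
  · refine ⟨{1}, by decide, by simp, ?_⟩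
    simp
    linarith
  · refine ⟨{0, 2}, by decide, by simp, ?_⟩
    have := w 1
    simp at this ⊢
    linarith
  · refine ⟨{1, 3}, by decide, by simp, ?_⟩
    have h1 := w 2
    have h2 := w' 1
    simp at h1 h2 ⊢
    linarith
  · refine ⟨{2, 4}, by decide, by simp, ?_⟩
    have h1 := w 3
    have h2 := w' 2
    simp at h1 h2 ⊢
    linarith
  · refine ⟨{3}, by decide, by simp, ?_⟩
    have := w' 3
    simp at this ⊢
    linarith

end IsLocallyPositive

end CoxeterMatrix

namespace SimpleGraph

variable {V : Type*} {G : SimpleGraph V}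

/-- In a rooted tree, parents are unique. -/
theorem IsTree.eq_of_adj_of_dist_lt (hG : G.IsTree) {r a b x : V} (ha : G.Adj a x)
    (hb : G.Adj b x) (had : G.dist r a < G.dist r x) (hbd : G.dist r b < G.dist r x) : a = b := by
  have key {c : V} (hc : G.Adj c x) (hcd : G.dist r c < G.dist r x) :
      ∃ p : G.Walk r x, p.IsPath ∧ p.penultimate = c := by
    obtain ⟨p, hp⟩ := hG.connected.exists_walk_length_eq_dist r c
    refine ⟨p.concat hc, Walk.isPath_of_length_eq_dist _ ?_, by simp⟩
    have := hG.dist_eq_dist_add_one_of_adj r hc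
    rw [Walk.length_concat]
    omega
  obtain ⟨p, hp, rfl⟩ := key ha had
  obtain ⟨q, hq, rfl⟩ := key hb hbd
  rw [(hG.existsUnique_path r x).unique hp hq]

theorem IsTree.dist_eq_add_one_of_adj_of_ne (hG : G.IsTree) {r a x y : V} (hax : G.Adj a x)
    (had : G.dist r a < G.dist r x) (hxy : G.Adj x y) (hya : y ≠ a) :
    G.dist r y = G.dist r x + 1 := by
  have h1 := hG.dist_eq_dist_add_one_of_adj r hxy
  have h2 : ¬ G.dist r y < G.dist r x := fun h => hya (hG.eq_of_adj_of_dist_lt hxy.symm hax h had)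
  omega

theorem exists_ray_of_step (r : V) {P : V → Prop}
    (hP : ∀ x, P x → ∃ y, G.Adj x y ∧ G.dist r y = G.dist r x + 1 ∧ P y) {x : V} (hx : P x) :
    ∃ f : ℕ → V, f 0 = x ∧ (∀ n, G.Adj (f n) (f (n + 1))) ∧
      ∀ n, G.dist r (f n) = G.dist r x + n := by
  choose! s hs using hP
  have hPs (n : ℕ) : P (s^[n] x) := by
    induction n with
    | zero => exact hx
    | succ n ih => rw [Function.iterate_succ_apply']; exact (hs _ ih).2.2
  refine ⟨fun n => s^[n] x, rfl, fun n => ?_, fun n => ?_⟩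
  · simp only [Function.iterate_succ_apply']
    exact (hs _ (hPs n)).1
  · induction n with
    | zero => rfl
    | succ n ih =>
      simp only [Function.iterate_succ_apply'] at ih ⊢
      rw [(hs _ (hPs n)).2.1, ih, add_assoc]

/-- Kőnig's lemma: an infinite locally finite connected graph has a geodesic ray from any root. -/
theorem Connected.exists_ray [Infinite V] (hG : G.Connected)
    (hfin : ∀ x, (G.neighborSet x).Finite) (r : V) :
    ∃ f : ℕ → V, f 0 = r ∧ (∀ n, G.Adj (f n) (f (n + 1))) ∧ ∀ n, G.dist r (f n) = n := by
  have := G.exists_ray_of_step r (x := r)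
    (P := fun x => {y | G.dist r y = G.dist r x + G.dist x y}.Infinite) ?_ ?_
  · simpa using this
  · intro x hx
    by_contra! hcon
    refine hx ?_
    have hsub : {y | G.dist r y = G.dist r x + G.dist x y} ⊆ {x} ∪
        ⋃ c ∈ {c ∈ G.neighborSet x | G.dist r c = G.dist r x + 1},
          {y | G.dist r y = G.dist r c + G.dist c y} := by
      intro y hy
      rw [Set.mem_ofPred_eq] at hy
      obtain ⟨p, hp⟩ := hG.exists_walk_length_eq_dist x y
      cases p with
      | nil => simp
      | @cons _ c _ hxc q =>
        rw [Walk.length_cons] at hp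
        have h1 : G.dist c y ≤ q.length := dist_le q
        have h2 : G.dist r y ≤ G.dist r c + G.dist c y := hG.dist_triangle
        have h3 : G.dist r c ≤ G.dist r x + G.dist x c := hG.dist_triangle
        rw [dist_eq_one_iff_adj.2 hxc] at h3
        refine Or.inr (Set.mem_biUnion (x := c) ⟨hxc, by omega⟩ ?_)
        rw [Set.mem_ofPred_eq]
        omega
    refine Set.Finite.subset ((Set.finite_singleton x).union
      (Set.Finite.biUnion ((hfin x).subset fun c hc => hc.1) fun c hc => ?_)) hsub
    exact hcon c hc.1 hc.2
  · simpa using Set.infinite_univ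

theorem injective_of_dist_eq {r : V} {f : ℕ → V} {d : ℕ} (hf : ∀ n, G.dist r (f n) = d + n) :
    f.Injective := fun m n h => by
  have h1 := hf m
  rw [h, hf n] at h1
  omega

/-- A map from a nonempty type whose range is closed under adjacency is onto a connected graph. -/
theorem Connected.surjective_of_adj_closed {X : Type*} [Nonempty X] (hG : G.Connected) {f : X → V}
    (hf : ∀ x y, G.Adj (f x) y → ∃ z, f z = y) : f.Surjective := by
  have key {a b : V} (p : G.Walk a b) : (∃ x, f x = a) → ∃ x, f x = b := by
    induction p with
    | nil => exact id
    | cons h p ih =>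
      rintro ⟨x, rfl⟩
      exact ih (hf x _ h)
  intro y
  obtain ⟨p⟩ := hG (f (Classical.arbitrary X)) y
  exact key p ⟨_, rfl⟩

end SimpleGraph

/-- The sequence obtained by prepending a term. -/
def natCons {B : Type*} (b : B) (f : ℕ → B) : ℕ → B
  | 0 => b
  | n + 1 => f n

theorem natCons_injective {B : Type*} {b : B} {f : ℕ → B} (hf : f.Injective) (hb : ∀ n, f n ≠ b) :
    (natCons b f).Injective := by
  rintro (_ | m) (_ | n) h
  · rfl
  · exact (hb n h.symm).elim
  · exact (hb m h).elim
  · rw [hf h]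

namespace CoxeterMatrix

variable {B : Type*} {M : CoxeterMatrix B}

/-- A parametrization of the vertices that identifies the neighbours and labels of each vertex
identifies the whole Coxeter matrix. -/
theorem exists_equiv_entry (hconn : M.graph.Connected) {X : Type*} [Nonempty X] {f : X → B}
    (hf : f.Injective) {R : X → X → Prop} {entry : X → X → ℕ}
    (hR : ∀ x y, M.graph.Adj (f x) y → ∃ z, R x z ∧ f z = y) (hself : ∀ x, entry x x = 1)
    (hrel : ∀ x z, R x z → M (f x) (f z) = entry x z)
    (hne : ∀ x z, x ≠ z → ¬ R x z → entry x z = 2) :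
    ∃ e : B ≃ X, ∀ i j, M i j = entry (e i) (e j) := by
  have hsurj : f.Surjective := hconn.surjective_of_adj_closed fun x y h =>
    (hR x y h).imp fun _ => And.right
  let e := Equiv.ofBijective f ⟨hf, hsurj⟩
  refine ⟨e.symm, fun i j => ?_⟩
  obtain ⟨x, rfl⟩ := e.surjective i
  obtain ⟨z, rfl⟩ := e.surjective j
  rw [e.symm_apply_apply, e.symm_apply_apply]
  change M (f x) (f z) = entry x z
  obtain rfl | hxz := eq_or_ne x z
  · rw [hself, M.diagonal]
  by_cases h : R x z
  · exact hrel x z h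
  · rw [hne x z hxz h]
    refine eq_two_of_not_adj (hf.ne hxz) fun hadj => h ?_
    obtain ⟨z', hz', heq⟩ := hR x _ hadj
    rwa [← hf heq]

namespace IsLocallyPositive

/-- The case of a branch vertex. -/
theorem exists_equiv_dInf [Infinite B] (h : M.IsLocallyPositive) (hconn : M.graph.Connected)
    {r : B} {T : Finset B} (hT : ∀ x ∈ T, M.graph.Adj r x) (hcard : T.card = 3) :
    ∃ e : B ≃ ℕ, ∀ i j, M i j = dInfEntry (e i) (e j) := by
  classical
  have hG : M.graph.IsTree := ⟨hconn, h.isAcyclic⟩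
  obtain ⟨f, rfl, hadj, hdist⟩ := hconn.exists_ray h.finite_neighborSet r
  have hinj : f.Injective := SimpleGraph.injective_of_dist_eq (d := 0) (by simpa using hdist)
  obtain ⟨u, hu, v, hv, huv⟩ : ∃ u ∈ T.erase (f 1), ∃ v ∈ T.erase (f 1), u ≠ v := by
    refine Finset.one_lt_card.1 ?_
    have := Finset.pred_card_le_card_erase (s := T) (a := f 1)
    omega
  obtain ⟨hu1, hu⟩ := Finset.mem_erase.1 hu
  obtain ⟨hv1, hv⟩ := Finset.mem_erase.1 hv
  replace hu := hT u hu
  replace hv := hT v hv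
  have hne {w : B} (hw : M.graph.Adj (f 0) w) (hw1 : w ≠ f 1) (n : ℕ) : f n ≠ w := by
    rintro rfl
    have := hdist n
    rw [SimpleGraph.dist_eq_one_iff_adj.2 hw] at this
    exact hw1 (by rw [← this])
  have hD {u v : B} (hu : M.graph.Adj (f 0) u) (hv : M.graph.Adj (f 0) v) (hu1 : u ≠ f 1)
      (hv1 : v ≠ f 1) (huv : u ≠ v) : (natCons u (natCons v f)).Injective :=
    natCons_injective (natCons_injective hinj (hne hv hv1)) <| by
      rintro (_ | n)
      exacts [huv.symm, hne hu hu1 n]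
  have hroot {y : B} (hy : M.graph.Adj (f 0) y) : y = u ∨ y = v ∨ y = f 1 := by
    by_contra! hcon
    refine h.card_ne_four_of_adj (r := f 0) (T := {y, u, v, f 1}) ?_ ?_
    · have := hadj 0
      simp_all
    · rw [Finset.card_insert_of_notMem, Finset.card_insert_of_notMem,
        Finset.card_insert_of_notMem, Finset.card_singleton] <;> simp_all
  have hleaf {u v : B} (hu : M.graph.Adj (f 0) u) (hv : M.graph.Adj (f 0) v) (hu1 : u ≠ f 1)
      (hv1 : v ≠ f 1) (huv : u ≠ v) {y : B} (hy : M.graph.Adj u y) : y = f 0 := by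
    by_contra hy0
    have hdu := SimpleGraph.dist_eq_one_iff_adj.2 hu
    have hdv := SimpleGraph.dist_eq_one_iff_adj.2 hv
    have hdy := hG.dist_eq_add_one_of_adj_of_ne (r := f 0) hu (by simp [hdu]) hy hy0
    refine h.not_affineE (g := natCons y (natCons u (natCons v f)))
      (natCons_injective (hD hu hv hu1 hv1 huv) ?_) hy.symm hu.symm hv.symm ?_
    · rintro (_ | _ | n) rfl
      · exact hy.ne rfl
      · change M.graph.dist (f 0) v = _ at hdy
        omega
      · change M.graph.dist (f 0) (f n) = _ at hdy
        obtain rfl : n = 2 := by have := hdist n; omega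
        refine hu1 (hG.eq_of_adj_of_dist_lt (r := f 0) hy (hadj 1) ?_ ?_)
        · change M.graph.dist (f 0) u < M.graph.dist (f 0) (f 2)
          rw [hdu, hdist]; norm_num
        · change M.graph.dist (f 0) (f 1) < M.graph.dist (f 0) (f 2)
          rw [hdist, hdist]; norm_num
    · intro k hk
      obtain ⟨k, rfl⟩ := Nat.exists_eq_add_of_le' hk
      exact hadj k
  have harm {n : ℕ} {y : B} (hy : M.graph.Adj (f (n + 1)) y) : y = f n ∨ y = f (n + 2) := by
    by_contra! hcon
    have hdy := hG.dist_eq_add_one_of_adj_of_ne (r := f 0) (hadj n)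
      (by rw [hdist, hdist]; omega) hy hcon.1
    rw [hdist] at hdy
    refine h.not_affineD (g := natCons y (natCons u (natCons v f))) (n := n)
      (natCons_injective (hD hu hv hu1 hv1 huv) ?_) hy.symm hu.symm hv.symm ?_
    · rintro (_ | _ | m) rfl
      · change M.graph.dist (f 0) u = _ at hdy
        rw [SimpleGraph.dist_eq_one_iff_adj.2 hu] at hdy
        omega
      · change M.graph.dist (f 0) v = _ at hdy
        rw [SimpleGraph.dist_eq_one_iff_adj.2 hv] at hdy
        omega
      · change M.graph.dist (f 0) (f m) = _ at hdy
        rw [hdist] at hdy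
        exact hcon.2 (congrArg f hdy)
    · intro k hk
      obtain ⟨k, rfl⟩ := Nat.exists_eq_add_of_le' hk
      exact hadj k
  have hheavy (n : ℕ) : ¬ M.IsHeavy (f n) (f (n + 1)) :=
    h.not_affineB (n := n) (hD hu hv hu1 hv1 huv) hu.symm hv.symm fun k hk _ => by
      obtain ⟨k, rfl⟩ := Nat.exists_eq_add_of_le' hk
      exact hadj k
  have hheavy' {u v : B} (hu : M.graph.Adj (f 0) u) (hv : M.graph.Adj (f 0) v) (hu1 : u ≠ f 1)
      (hv1 : v ≠ f 1) (huv : u ≠ v) : ¬ M.IsHeavy (f 0) u := by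
    refine h.not_affineB (n := 0)
      (g := natCons v (natCons (f 1) (natCons (f 0) (natCons u fun n => f (n + 2)))))
      (natCons_injective (natCons_injective (natCons_injective (natCons_injective
        (fun m n hmn => by simpa using hinj hmn) fun n => hne hu hu1 _) ?_) ?_) ?_)
      hv.symm (hadj 0).symm fun k _ _ => by omega
    · rintro (_ | n)
      exacts [hu.ne', fun h => by simpa using hinj h]
    · rintro (_ | _ | n)
      exacts [(hadj 0).ne, hu1, fun h => by simpa using hinj h]
    · rintro (_ | _ | _ | n)
      exacts [hv1.symm, hv.ne, huv, hne hv hv1 _]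
  have h3 (n : ℕ) : M (f n) (f (n + 1)) = 3 := eq_three_of_adj (hadj n) (hheavy n)
  have hu3 : M (f 0) u = 3 := eq_three_of_adj hu (hheavy' hu hv hu1 hv1 huv)
  have hv3 : M (f 0) v = 3 := eq_three_of_adj hv (hheavy' hv hu hv1 hu1 huv.symm)
  refine exists_equiv_entry hconn (hD hu hv hu1 hv1 huv) (entry := dInfEntry)
    (R := fun i j => (i = 0 ∧ j = 2) ∨ (i = 2 ∧ j = 0) ∨ (i = 1 ∧ j = 2) ∨ (i = 2 ∧ j = 1) ∨
      (2 ≤ i ∧ i + 1 = j) ∨ (2 ≤ j ∧ j + 1 = i)) ?_ (by simp [dInfEntry]) ?_ ?_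
  · rintro (_ | _ | _ | n) y hy
    · exact ⟨2, by simp, (hleaf hu hv hu1 hv1 huv hy).symm⟩
    · exact ⟨2, by simp, (hleaf hv hu hv1 hu1 huv.symm hy).symm⟩
    · obtain rfl | rfl | rfl := hroot hy
      exacts [⟨0, by simp, rfl⟩, ⟨1, by simp, rfl⟩, ⟨3, by simp, rfl⟩]
    · obtain rfl | rfl := harm hy
      exacts [⟨n + 2, by simp, rfl⟩, ⟨n + 4, by simp, rfl⟩]
  · intro i j hij
    have hentry : dInfEntry i j = 3 := by
      rw [dInfEntry, if_neg (by omega), if_pos hij]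
    rw [hentry]
    obtain ⟨rfl, rfl⟩ | ⟨rfl, rfl⟩ | ⟨rfl, rfl⟩ | ⟨rfl, rfl⟩ | ⟨hi, rfl⟩ | ⟨hj, rfl⟩ := hij
    · rw [M.symmetric]; exact hu3
    · exact hu3
    · rw [M.symmetric]; exact hv3
    · exact hv3
    · obtain ⟨i, rfl⟩ := Nat.exists_eq_add_of_le' hi
      exact h3 i
    · obtain ⟨j, rfl⟩ := Nat.exists_eq_add_of_le' hj
      rw [M.symmetric]; exact h3 j
  · intro i j hij hR
    rw [dInfEntry, if_neg hij, if_neg hR]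

theorem not_isHeavy_of_path (h : M.IsLocallyPositive) {f : ℕ → B} (hf : f.Injective)
    (hadj : ∀ n, M.graph.Adj (f n) (f (n + 1))) (n : ℕ) : ¬ M.IsHeavy (f (n + 1)) (f (n + 2)) :=
  h.not_affineF (g := fun k => f (n + k)) (fun k l hkl => by simpa using hf hkl)
    fun k => hadj (n + k)

/-- The case of a leaf in a graph without branch vertices. -/
theorem exists_equiv_aInf_or_bInf [Infinite B] (h : M.IsLocallyPositive)
    (hconn : M.graph.Connected)
    (hdeg : ∀ ⦃r a b y⦄, M.graph.Adj r a → M.graph.Adj r b → a ≠ b → M.graph.Adj r y →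
      y = a ∨ y = b)
    {r : B} (hr : ∀ ⦃a b⦄, M.graph.Adj r a → M.graph.Adj r b → a = b) :
    (∃ e : B ≃ ℕ, ∀ i j, M i j = aInfEntry (e i) (e j)) ∨
    (∃ e : B ≃ ℕ, ∀ i j, M i j = bInfEntry (e i) (e j)) := by
  obtain ⟨f, rfl, hadj, hdist⟩ := hconn.exists_ray h.finite_neighborSet r
  have hinj : f.Injective := SimpleGraph.injective_of_dist_eq (d := 0) (by simpa using hdist)
  have h3 (n : ℕ) : M (f (n + 1)) (f (n + 2)) = 3 :=
    eq_three_of_adj (hadj _) (h.not_isHeavy_of_path hinj hadj n)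
  have hR : ∀ x y, M.graph.Adj (f x) y → ∃ z, (x + 1 = z ∨ z + 1 = x) ∧ f z = y := by
    rintro (_ | n) y hy
    · exact ⟨1, by simp, hr (hadj 0) hy⟩
    · obtain rfl | rfl := hdeg (hadj n).symm (hadj (n + 1)) (fun h => by have := hinj h; omega) hy
      exacts [⟨n, by simp, rfl⟩, ⟨n + 2, by simp, rfl⟩]
  by_cases h0 : M.IsHeavy (f 0) (f 1)
  · right
    have h4 : M (f 0) (f 1) = 4 := by
      have := h.not_hyperbolicH hinj hadj
      rw [IsHeavy] at h0
      omega
    have key (n : ℕ) : M (f n) (f (n + 1)) = bInfEntry n (n + 1) := by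
      cases n with
      | zero => simpa [bInfEntry] using h4
      | succ n => simpa [bInfEntry] using h3 n
    have hsymm (n : ℕ) : bInfEntry (n + 1) n = bInfEntry n (n + 1) := by
      cases n <;> simp [bInfEntry]
    refine exists_equiv_entry hconn hinj hR (by simp [bInfEntry]) ?_ ?_
    · rintro x z (rfl | rfl)
      · exact key x
      · rw [M.symmetric, hsymm, key]
    · intro x z hxz hxz'
      rw [bInfEntry, if_neg hxz, if_neg (by omega), if_neg hxz']
  · left
    have key (n : ℕ) : M (f n) (f (n + 1)) = 3 := by
      cases n with
      | zero => exact eq_three_of_adj (hadj 0) h0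
      | succ n => exact h3 n
    refine exists_equiv_entry hconn hinj hR (by simp [aInfEntry]) ?_ ?_
    · intro x z hxz
      rw [aInfEntry, if_neg (by omega), if_pos hxz]
      obtain rfl | rfl := hxz
      · exact key x
      · rw [M.symmetric, key]
    · intro x z hxz hxz'
      rw [aInfEntry, if_neg hxz, if_neg hxz']

/-- The case where every vertex has exactly two neighbours. -/
theorem exists_equiv_aZZ [Nonempty B] (h : M.IsLocallyPositive) (hconn : M.graph.Connected)
    (hdeg : ∀ ⦃r a b y⦄, M.graph.Adj r a → M.graph.Adj r b → a ≠ b → M.graph.Adj r y →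
      y = a ∨ y = b)
    (htwo : ∀ r, ∃ a b, M.graph.Adj r a ∧ M.graph.Adj r b ∧ a ≠ b) :
    ∃ e : B ≃ ℤ, ∀ i j, M i j = aZZEntry (e i) (e j) := by
  have hG : M.graph.IsTree := ⟨hconn, h.isAcyclic⟩
  let r : B := Classical.arbitrary B
  obtain ⟨a, b, ha, hb, hab⟩ := htwo r
  have hchild (x : B) : ∃ y, M.graph.Adj x y ∧ M.graph.dist r y = M.graph.dist r x + 1 := by
    obtain ⟨c, d, hc, hd, hcd⟩ := htwo x
    by_contra! hcon
    refine hcd (hG.eq_of_adj_of_dist_lt (r := r) hc.symm hd.symm ?_ ?_)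
    · have := hG.dist_eq_dist_add_one_of_adj r hc
      have := hcon c hc
      omega
    · have := hG.dist_eq_dist_add_one_of_adj r hd
      have := hcon d hd
      omega
  have hray (x : B) := SimpleGraph.exists_ray_of_step r (P := fun _ => True) (x := x)
    (fun x _ => by simpa using hchild x) trivial
  have hda := SimpleGraph.dist_eq_one_iff_adj.2 ha
  have hdb := SimpleGraph.dist_eq_one_iff_adj.2 hb
  obtain ⟨p, hp0, hpadj, hpdist⟩ := hray a
  obtain ⟨q, hq0, hqadj, hqdist⟩ := hray b
  rw [hda] at hpdist
  rw [hdb] at hqdist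
  have hpq (n : ℕ) : p n ≠ q n := by
    induction n with
    | zero => rwa [hp0, hq0]
    | succ n ih =>
      intro heq
      refine ih (hG.eq_of_adj_of_dist_lt (r := r) (hpadj n) (heq ▸ hqadj n) ?_ ?_)
      · rw [hpdist, hpdist]; omega
      · rw [hpdist, hqdist]; omega
  let g : ℤ → B
    | .ofNat n => natCons r p n
    | .negSucc n => q n
  have hg : g.Injective := by
    have hp : (natCons r p).Injective := by
      refine natCons_injective (SimpleGraph.injective_of_dist_eq hpdist) fun n hn => ?_
      have := hpdist n
      rw [hn, SimpleGraph.dist_self] at this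
      omega
    have hne (m n : ℕ) : natCons r p m ≠ q n := by
      intro heq
      have hq := hqdist n
      cases m with
      | zero =>
        rw [← heq, natCons, SimpleGraph.dist_self] at hq
        omega
      | succ m =>
        rw [← heq, natCons, hpdist] at hq
        obtain rfl : m = n := by omega
        exact hpq m heq
    rintro (m | m) (n | n) hmn
    · rw [hp hmn]
    · exact (hne m n hmn).elim
    · exact (hne n m hmn.symm).elim
    · rw [SimpleGraph.injective_of_dist_eq hqdist hmn]
  have hgadj (z : ℤ) : M.graph.Adj (g z) (g (z + 1)) := by
    obtain (_ | n) | (_ | n) := z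
    · change M.graph.Adj r (p 0)
      rwa [hp0]
    · exact hpadj n
    · change M.graph.Adj (q 0) r
      rw [hq0]
      exact hb.symm
    · exact (hqadj n).symm
  have hgadj' (z : ℤ) : M.graph.Adj (g z) (g (z - 1)) := by
    have := (hgadj (z - 1)).symm
    rwa [sub_add_cancel] at this
  have key (z : ℤ) : M (g z) (g (z + 1)) = 3 := by
    refine eq_three_of_adj (hgadj z) ?_
    have := h.not_isHeavy_of_path (f := fun k => g (z - 1 + k))
      (fun k l hkl => by simpa using hg hkl) (fun k => by
        have := hgadj (z - 1 + k)
        rwa [add_assoc] at this) 0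
    have h0 : z - 1 + ((0 + 1 : ℕ) : ℤ) = z := by push_cast; ring
    have h2 : z - 1 + ((0 + 2 : ℕ) : ℤ) = z + 1 := by push_cast; ring
    simpa only [h0, h2] using this
  refine exists_equiv_entry hconn hg (R := fun i j => i + 1 = j ∨ j + 1 = i) ?_
    (by simp [aZZEntry]) ?_ ?_
  · intro x y hy
    obtain rfl | rfl := hdeg (hgadj x) (hgadj' x) (fun h => by have := hg h; omega) hy
    exacts [⟨x + 1, by simp, rfl⟩, ⟨x - 1, by simp, rfl⟩]
  · intro x z hxz
    rw [aZZEntry, if_neg (by omega), if_pos hxz]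
    obtain rfl | rfl := hxz
    · exact key x
    · rw [M.symmetric, key]
  · intro x z hxz hxz'
    rw [aZZEntry, if_neg hxz, if_neg hxz']

end IsLocallyPositive

end CoxeterMatrix

theorem CoxeterSystem.infinite_index {B W : Type*} [Group W] {M : CoxeterMatrix B}
    (cs : CoxeterSystem M W) (hinf : Infinite W)
    (hfin : ∀ I : Set B, I.Finite →
      ((Subgroup.closure (cs.simple '' I) : Subgroup W) : Set W).Finite) :
    Infinite B := by
  by_contra hB
  rw [not_infinite_iff_finite] at hB
  have := hfin Set.univ Set.finite_univ
  rw [Set.image_univ, cs.subgroup_closure_range_simple, Subgroup.coe_top] at this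
  exact Set.infinite_univ this

/-- An irreducible infinite Coxeter system all of whose
finitely generated standard parabolic subgroups are finite has Coxeter graph
isomorphic to `A_∞`, `B_∞`, `D_∞` or `A_{∞,∞}`. -/
theorem stmt_18 {B W : Type*} [Group W] {M : CoxeterMatrix B}
    (cs : CoxeterSystem M W)
    (hirr : ∀ s t : B, Relation.ReflTransGen (fun a b => a ≠ b ∧ M a b ≠ 2) s t)
    (hinf : Infinite W)
    (hfinpar : ∀ I : Set B, I.Finite →
      ((Subgroup.closure (cs.simple '' I) : Subgroup W) : Set W).Finite) :
    (∃ e : B ≃ ℕ, ∀ i j, M i j = aInfEntry (e i) (e j)) ∨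
    (∃ e : B ≃ ℕ, ∀ i j, M i j = bInfEntry (e i) (e j)) ∨
    (∃ e : B ≃ ℕ, ∀ i j, M i j = dInfEntry (e i) (e j)) ∨
    (∃ e : B ≃ ℤ, ∀ i j, M i j = aZZEntry (e i) (e j)) := by
  classical
  have hpos := cs.isLocallyPositive hfinpar
  have hB := cs.infinite_index hinf hfinpar
  have hconn : M.graph.Connected :=
    ⟨fun s t => (SimpleGraph.reachable_iff_reflTransGen s t).2 (hirr s t)⟩
  by_cases hbranch : ∃ (r : B) (T : Finset B), (∀ x ∈ T, M.graph.Adj r x) ∧ T.card = 3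
  · obtain ⟨r, T, hT, hcard⟩ := hbranch
    exact Or.inr (Or.inr (Or.inl (hpos.exists_equiv_dInf hconn hT hcard)))
  have hdeg : ∀ ⦃r a b y⦄, M.graph.Adj r a → M.graph.Adj r b → a ≠ b → M.graph.Adj r y →
      y = a ∨ y = b := by
    intro r a b y ha hb hab hy
    by_contra! hcon
    exact hbranch ⟨r, {y, a, b}, by simp [ha, hb, hy],
      Finset.card_eq_three.2 ⟨y, a, b, hcon.1, hcon.2, hab, rfl⟩⟩
  by_cases hleaf : ∃ r, ∀ ⦃a b⦄, M.graph.Adj r a → M.graph.Adj r b → a = b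
  · obtain ⟨r, hr⟩ := hleaf
    obtain h | h := hpos.exists_equiv_aInf_or_bInf hconn hdeg hr
    · exact Or.inl h
    · exact Or.inr (Or.inl h)
  · push Not at hleaf
    refine Or.inr (Or.inr (Or.inr (hpos.exists_equiv_aZZ hconn hdeg hleaf)))
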